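/- Fourier multiplier of the reduced taming X-ray transform: fix ε > 0 and let g : ℂ×ℝ → ℂ be π(1+2ε²)-periodic in t with g ∈ L¹(ℂ×[0,π(1+2ε²))). Then for every n ∈ ℤ∖{0}, every F ∈ 𝓗 and every ζ ∈ ℂ, ∫_{ℂ×[0,π(1+2ε²))} (I^{ε,red} g)(z,t) · (β_{n/(1+2ε²)}(z,t)*F)(ζ) dz dt = 2π · (𝒥_n(1/√(1+2ε²)) G)(ζ), where I^{ε,red} g(z,t) = ∫₀^{2π} g((z,t)·γ^ε_1(s)) ds with γ^ε_1(s) = (e^{is}, s(1+2ε²)/2), and G(ζ) = ∫_{ℂ×[0,π(1+2ε²))} g(z,t)(β_{n/(1+2ε²)}(z,t)*F)(ζ) dz dt. -/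

import Mathlib

noncomputable section

open Complex MeasureTheory Real Set

/-- Heisenberg group multiplication on ℂ × ℝ. -/
def hmul (p q : ℂ × ℝ) : ℂ × ℝ :=
  (p.1 + q.1, p.2 + q.2 + (p.1.re * q.1.im - p.1.im * q.1.re) / 2)

/-- The model sub-Riemannian geodesic of charge `lam`:
`γ_λ(s) = (R e^{i s / R}, s R / 2)` with `R = 1/λ`. -/
def geo (lam : ℝ) (s : ℝ) : ℂ × ℝ :=
  (((lam : ℂ))⁻¹ * Complex.exp (Complex.I * ((lam * s : ℝ) : ℂ)), s / (2 * lam))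

/-- The sub-Riemannian X-ray transform `I_λ f (z,t) = ∫ f((z,t)·γ_λ(s)) ds`. -/
def xray (lam : ℝ) (f : ℂ × ℝ → ℂ) (p : ℂ × ℝ) : ℂ :=
  ∫ s : ℝ, f (hmul p (geo lam s))

/-- The model `g_ε`-geodesic of charge `lam`:
`γ^ε_λ(s) = (R e^{i s/R}, s (R² + 2ε²)/(2R))` with `R = 1/λ`. -/
def geoE (eps lam : ℝ) (s : ℝ) : ℂ × ℝ :=
  (((lam : ℂ))⁻¹ * Complex.exp (Complex.I * ((lam * s : ℝ) : ℂ)),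
    s * (1 / lam ^ 2 + 2 * eps ^ 2) * lam / 2)

/-- The taming X-ray transform `I^ε_λ f (z,t) = ∫ f((z,t)·γ^ε_λ(s)) ds`. -/
def xrayE (eps lam : ℝ) (f : ℂ × ℝ → ℂ) (p : ℂ × ℝ) : ℂ :=
  ∫ s : ℝ, f (hmul p (geoE eps lam s))

/-- The Bargmann–Fock representation for `h > 0`, acting pointwise. -/
def betaP (h : ℝ) (z : ℂ) (t : ℝ) (F : ℂ → ℂ) (ζ : ℂ) : ℂ :=
  Complex.exp (2 * Complex.I * (h : ℂ) * (t : ℂ) - ((Real.sqrt h : ℝ) : ℂ) * ζ * (starRingEnd ℂ) z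
      - ((h : ℂ) / 2) * ((Complex.normSq z : ℝ) : ℂ)) * F (ζ + ((Real.sqrt h : ℝ) : ℂ) * z)

/-- The Bargmann–Fock representation `β_h(z,t)` for `h ≠ 0`:
for `h < 0` it is `β_{|h|}(conj z, −t)`. -/
def beta (h : ℝ) (z : ℂ) (t : ℝ) (F : ℂ → ℂ) (ζ : ℂ) : ℂ :=
  if 0 < h then betaP h z t F ζ else betaP |h| ((starRingEnd ℂ) z) (-t) F ζ

/-- The adjoint `β_h(z,t)* = β_h((z,t)⁻¹) = β_h(−z,−t)`. -/
def betaStar (h : ℝ) (p : ℂ × ℝ) (F : ℂ → ℂ) (ζ : ℂ) : ℂ :=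
  beta h (-p.1) (-p.2) F ζ

/-- Membership in Bargmann–Fock space `𝓗`: entire with
`(1/π) ∫_ℂ |F(ζ)|² e^{−|ζ|²} dζ < ∞`. -/
def InFock (F : ℂ → ℂ) : Prop :=
  Differentiable ℂ F ∧
    Integrable (fun ζ : ℂ => ‖F ζ‖ ^ 2 * Real.exp (-Complex.normSq ζ))

/-- The group Fourier transform `𝓕_ℍ f(h)`, acting pointwise on `F ∈ 𝓗`:
`(𝓕_ℍ f(h) F)(ζ) = ∫_{ℂ×ℝ} f(z,t) (β_h(z,t)* F)(ζ) dz dt`. -/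
def fourierH (f : ℂ × ℝ → ℂ) (h : ℝ) (F : ℂ → ℂ) (ζ : ℂ) : ℂ :=
  ∫ p : ℂ × ℝ, f p * betaStar h p F ζ

/-- The multiplier operator `𝒥_n(r)`:
`(𝒥_n(r) F)(ζ) = (1/2π) ∫₀^{2π} (β_n(r e^{iθ}, θ/2) F)(ζ) dθ`. -/
def Jop (n : ℤ) (r : ℝ) (F : ℂ → ℂ) (ζ : ℂ) : ℂ :=
  ((1 / (2 * π) : ℝ) : ℂ) *
    ∫ θ in (0 : ℝ)..(2 * π), beta (n : ℝ) (((r : ℝ) : ℂ) * Complex.exp (Complex.I * (θ : ℂ))) (θ / 2) F ζ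

/-- The inverse in the Heisenberg group. -/
def hinv (p : ℂ × ℝ) : ℂ × ℝ := (-p.1, -p.2)

lemma hmul_hinv_cancel_right (p q : ℂ × ℝ) : hmul (hmul p q) (hinv q) = p := by
  ext <;> simp [hmul, hinv]
  ring

lemma hmul_hinv_cancel_left (p q : ℂ × ℝ) : hmul (hmul p (hinv q)) q = p := by
  ext <;> simp [hmul, hinv]
  ring

lemma hinv_hmul_hinv (p q : ℂ × ℝ) : hinv (hmul p (hinv q)) = hmul q (hinv p) := by
  refine Prod.ext ?_ ?_ <;> simp only [hmul, hinv, Complex.neg_re, Complex.neg_im] <;> ring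

lemma continuous_hmul : Continuous fun x : (ℂ × ℝ) × (ℂ × ℝ) => hmul x.1 x.2 := by
  unfold hmul
  fun_prop

lemma betaP_hmul {h : ℝ} (hh : 0 ≤ h) (p q : ℂ × ℝ) (F : ℂ → ℂ) (ζ : ℂ) :
    betaP h (hmul p q).1 (hmul p q).2 F ζ
      = betaP h p.1 p.2 (fun ξ => betaP h q.1 q.2 F ξ) ζ := by
  obtain ⟨k, hk, rfl⟩ : ∃ k : ℝ, 0 ≤ k ∧ h = k ^ 2 := ⟨√h, Real.sqrt_nonneg h, (Real.sq_sqrt hh).symm⟩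
  obtain ⟨z, t⟩ := p
  obtain ⟨w, s⟩ := q
  simp only [betaP, hmul, Real.sqrt_sq hk]
  rw [← mul_assoc, ← Complex.exp_add]
  congr 1
  · congr 1
    obtain ⟨x, y⟩ := z
    obtain ⟨u, v⟩ := w
    apply Complex.ext <;> simp [Complex.normSq_apply, pow_two] <;> ring
  · congr 1
    ring

/-- `β_h` is a representation of the Heisenberg group. -/
lemma beta_hmul (h : ℝ) (p q : ℂ × ℝ) (F : ℂ → ℂ) (ζ : ℂ) :
    beta h (hmul p q).1 (hmul p q).2 F ζ = beta h p.1 p.2 (fun ξ => beta h q.1 q.2 F ξ) ζ := by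
  by_cases hh : 0 < h
  · simpa only [beta, if_pos hh] using betaP_hmul hh.le p q F ζ
  · simp only [beta, if_neg hh]
    have := betaP_hmul (abs_nonneg h) ((starRingEnd ℂ) p.1, -p.2) ((starRingEnd ℂ) q.1, -q.2) F ζ
    rw [← this]
    congr 1
    · simp [hmul]
    · simp [hmul]
      ring

lemma betaStar_hmul_hinv (h : ℝ) (p q : ℂ × ℝ) (F : ℂ → ℂ) (ζ : ℂ) :
    betaStar h (hmul p (hinv q)) F ζ = beta h q.1 q.2 (fun ξ => betaStar h p F ξ) ζ := by
  have := beta_hmul h q (hinv p) F ζ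
  rw [← hinv_hmul_hinv] at this
  exact this

/-- Pointwise operators `β_h(z,t)` commute with integration against a scalar weight. -/
lemma integral_mul_beta {α : Type*} [MeasurableSpace α] (μ : Measure α) (h : ℝ) (z : ℂ) (t : ℝ)
    (w : α → ℂ) (Φ : α → ℂ → ℂ) (ζ : ℂ) :
    ∫ a, w a * beta h z t (Φ a) ζ ∂μ = beta h z t (fun ξ => ∫ a, w a * Φ a ξ ∂μ) ζ := by
  by_cases hh : 0 < h
  · simp only [beta, if_pos hh, betaP]
    simp only [mul_left_comm (w _), integral_const_mul]
  · simp only [beta, if_neg hh, betaP]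
    simp only [mul_left_comm (w _), integral_const_mul]

lemma betaP_dilate {h c : ℝ} (hc : 0 < c) (z : ℂ) (t : ℝ) (F : ℂ → ℂ) (ζ : ℂ) :
    betaP h (((1 / √c : ℝ) : ℂ) * z) t F ζ = betaP (h / c) z (c * t) F ζ := by
  have h1 : ((√(h / c) : ℝ) : ℂ) = ((√h : ℝ) : ℂ) * ((1 / √c : ℝ) : ℂ) := by
    rw [Real.sqrt_div' h hc.le]; push_cast; ring
  have h2 : ((h / c : ℝ) : ℂ) = (h : ℂ) * ((1 / √c : ℝ) : ℂ) ^ 2 := by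
    rw [← Complex.ofReal_pow, div_pow, Real.sq_sqrt hc.le]; push_cast; ring
  have h3 : ((h / c : ℝ) : ℂ) * ((c * t : ℝ) : ℂ) = (h : ℂ) * (t : ℂ) := by
    have : (c : ℂ) ≠ 0 := by exact_mod_cast hc.ne'
    push_cast; field_simp
  unfold betaP
  congr 1
  · congr 1
    rw [mul_assoc (2 * Complex.I) ((h / c : ℝ) : ℂ), h3, h1, h2]
    simp only [Complex.normSq_ofReal, map_mul, Complex.conj_ofReal]
    push_cast
    ring
  · rw [h1, mul_assoc]

lemma beta_dilate {h c : ℝ} (hc : 0 < c) (z : ℂ) (t : ℝ) (F : ℂ → ℂ) (ζ : ℂ) :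
    beta h (((1 / √c : ℝ) : ℂ) * z) t F ζ = beta (h / c) z (c * t) F ζ := by
  by_cases hh : 0 < h
  · simp only [beta, if_pos hh, if_pos (div_pos hh hc), betaP_dilate hc]
  · have hh' : ¬ 0 < h / c := fun H => hh ((div_pos_iff_of_pos_right hc).1 H)
    simp only [beta, if_neg hh, if_neg hh', map_mul, Complex.conj_ofReal, betaP_dilate hc,
      abs_div, abs_of_pos hc, mul_neg]

lemma betaP_add_period {h : ℝ} {T : ℝ} {n : ℤ} (hT : h * T = π * n) (z : ℂ) (t : ℝ)
    (F : ℂ → ℂ) (ζ : ℂ) : betaP h z (t + T) F ζ = betaP h z t F ζ := by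
  unfold betaP
  have hT' : (h : ℂ) * (T : ℂ) = (π : ℂ) * n := by exact_mod_cast hT
  have : 2 * Complex.I * (h : ℂ) * ((t + T : ℝ) : ℂ) - ((√h : ℝ) : ℂ) * ζ * (starRingEnd ℂ) z
      - ((h : ℂ) / 2) * ((Complex.normSq z : ℝ) : ℂ)
      = (2 * Complex.I * (h : ℂ) * (t : ℂ) - ((√h : ℝ) : ℂ) * ζ * (starRingEnd ℂ) z
      - ((h : ℂ) / 2) * ((Complex.normSq z : ℝ) : ℂ)) + n * (2 * π * Complex.I) := by
    push_cast
    linear_combination 2 * Complex.I * hT'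
  rw [this, Complex.exp_periodic.int_mul n]

lemma betaStar_add_period {h : ℝ} {T : ℝ} {n : ℤ} (hT : h * T = π * n) (z : ℂ) (t : ℝ)
    (F : ℂ → ℂ) (ζ : ℂ) : betaStar h (z, t + T) F ζ = betaStar h (z, t) F ζ := by
  by_cases hh : 0 < h
  · simp only [betaStar, beta, if_pos hh]
    rw [neg_add, betaP_add_period (n := -n) (by push_cast; linarith)]
  · simp only [betaStar, beta, if_neg hh]
    rw [neg_add, neg_add, neg_neg, neg_neg,
      betaP_add_period (n := -n) (by rw [abs_of_nonpos (not_lt.1 hh)]; push_cast; linarith)]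

/-- Gaussian mean value property of entire functions. -/
lemma integral_entire_mul_exp_neg_normSq {f : ℂ → ℂ} (hf : Differentiable ℂ f)
    (hi : Integrable fun u : ℂ => f u * ((Real.exp (-Complex.normSq u) : ℝ) : ℂ)) :
    ∫ u : ℂ, f u * ((Real.exp (-Complex.normSq u) : ℝ) : ℂ)
      = f 0 * ∫ u : ℂ, ((Real.exp (-Complex.normSq u) : ℝ) : ℂ) := by
  set w : ℂ → ℂ := fun u => ((Real.exp (-Complex.normSq u) : ℝ) : ℂ) with hw
  have hrot : ∀ θ : ℝ, MeasurePreserving (fun u : ℂ => circleMap 0 1 θ * u) := fun θ => by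
    have hθ : circleMap 0 1 θ ∈ Submonoid.unitSphere ℂ := by
      simp [Submonoid.unitSphere]
    exact (rotation ⟨circleMap 0 1 θ, hθ⟩).measurePreserving
  have hskew : MeasurePreserving
      (fun p : ℝ × ℂ => (p.1, circleMap 0 1 p.1 * p.2))
      ((volume.restrict (Set.uIoc 0 (2 * π))).prod volume)
      ((volume.restrict (Set.uIoc 0 (2 * π))).prod volume) := by
    refine (MeasurePreserving.id _).skew_product (g := fun θ u => circleMap 0 1 θ * u) ?_ ?_
    · refine Continuous.measurable ?_
      have := continuous_circleMap 0 1
      simp only [Function.uncurry_def]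
      fun_prop
    · exact Filter.Eventually.of_forall fun θ => (hrot θ).map_eq
  have hfin : IsFiniteMeasure ((volume : Measure ℝ).restrict (Set.uIoc 0 (2 * π))) :=
    isFiniteMeasure_restrict.2 (by simp [Set.uIoc])
  have hint : Integrable (Function.uncurry fun (θ : ℝ) (u : ℂ) =>
      f (circleMap 0 1 θ * u) * w (circleMap 0 1 θ * u))
      ((volume.restrict (Set.uIoc 0 (2 * π))).prod volume) :=
    hskew.integrable_comp_of_integrable (g := fun p : ℝ × ℂ => f p.2 * w p.2)
      (hi.comp_snd _)
  have hswap := intervalIntegral_integral_swap hint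
  have hmean : ∀ u : ℂ, ∫ θ in (0 : ℝ)..(2 * π),
      f (circleMap 0 1 θ * u) * w (circleMap 0 1 θ * u) = 2 * π * (f 0 * w u) := by
    intro u
    have h1 : ∀ θ, w (circleMap 0 1 θ * u) = w u := fun θ => by
      simp [hw, Complex.normSq_eq_norm_sq]
    simp only [h1, intervalIntegral.integral_mul_const]
    have h2 : Real.circleAverage (fun v => f (v * u)) 0 1 = f (0 * u) :=
      circleAverage_of_differentiable_on_off_countable Set.countable_empty
        (by have := hf.continuous; fun_prop) (fun z _ => by fun_prop)
    rw [Real.circleAverage_def, zero_mul, inv_smul_eq_iff₀ (by positivity)] at h2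
    rw [h2]
    simp
    ring
  have hconst : ∀ θ : ℝ, ∫ u : ℂ, f (circleMap 0 1 θ * u) * w (circleMap 0 1 θ * u)
      = ∫ u : ℂ, f u * w u := fun θ =>
    (hrot θ).integral_comp (Homeomorph.mulLeft₀ _ (circleMap_ne_center one_ne_zero)).measurableEmbedding
      (fun u => f u * w u)
  simp only [hmean, hconst, integral_const_mul, intervalIntegral.integral_const] at hswap
  have hpi : ((2 * π : ℝ) : ℂ) ≠ 0 := by exact_mod_cast (by positivity : (2 * π : ℝ) ≠ 0)
  refine mul_left_cancel₀ hpi ?_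
  rw [sub_zero, Complex.real_smul] at hswap
  rw [hswap]
  push_cast
  rfl

lemma integral_exp_neg_normSq_pos : 0 < ∫ u : ℂ, Real.exp (-Complex.normSq u) := by
  have := Complex.integral_exp_neg_mul_rpow (p := 2) (b := 1) (by norm_num) (by norm_num)
  simp only [Complex.normSq_eq_norm_sq]
  simp at this
  rw [this]
  positivity

/-- Pointwise growth bound for functions in Bargmann–Fock space. -/
lemma InFock.norm_le {F : ℂ → ℂ} (hF : InFock F) :
    ∃ C : ℝ, ∀ w : ℂ, ‖F w‖ ≤ C * Real.exp (Complex.normSq w / 2) := by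
  obtain ⟨hd, hi⟩ := hF
  set M := ∫ ζ : ℂ, ‖F ζ‖ ^ 2 * Real.exp (-Complex.normSq ζ) with hM
  set κ := ∫ u : ℂ, Real.exp (-Complex.normSq u) with hκ
  have hκ0 : 0 < κ := integral_exp_neg_normSq_pos
  refine ⟨√(M / κ), fun w => ?_⟩
  set f : ℂ → ℂ := fun u => (F (w + u) * Complex.exp (-(u * (starRingEnd ℂ) w))) ^ 2 with hf
  have hfd : Differentiable ℂ f := by fun_prop
  have hnorm : ∀ u : ℂ, ‖f u * ((Real.exp (-Complex.normSq u) : ℝ) : ℂ)‖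
      = Real.exp (Complex.normSq w) * (‖F (w + u)‖ ^ 2 * Real.exp (-Complex.normSq (w + u))) := by
    intro u
    rw [norm_mul, Complex.norm_real, Real.norm_of_nonneg (Real.exp_pos _).le, hf, norm_pow,
      norm_mul, Complex.norm_exp, mul_pow, ← Real.exp_nat_mul, mul_assoc, ← Real.exp_add,
      mul_left_comm, ← Real.exp_add]
    congr 2
    simp [Complex.normSq_apply]
    ring
  have hnint : Integrable fun u : ℂ =>
      Real.exp (Complex.normSq w) * (‖F (w + u)‖ ^ 2 * Real.exp (-Complex.normSq (w + u))) :=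
    (hi.comp_add_left w).const_mul _
  have hint : Integrable fun u : ℂ => f u * ((Real.exp (-Complex.normSq u) : ℝ) : ℂ) := by
    have hc : Continuous fun u : ℂ => f u * ((Real.exp (-Complex.normSq u) : ℝ) : ℂ) := by
      have := hfd.continuous
      have := Complex.continuous_normSq
      fun_prop
    rw [← integrable_norm_iff hc.aestronglyMeasurable]
    simpa only [hnorm] using hnint
  have hle := norm_integral_le_integral_norm (μ := volume)
    (fun u : ℂ => f u * ((Real.exp (-Complex.normSq u) : ℝ) : ℂ))
  rw [integral_entire_mul_exp_neg_normSq hfd hint,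
    integral_complex_ofReal] at hle
  simp only [hnorm, integral_const_mul] at hle
  rw [integral_add_left_eq_self (fun u : ℂ => ‖F u‖ ^ 2 * Real.exp (-Complex.normSq u)) w, ← hM,
    norm_mul, ← hκ, Complex.norm_real, Real.norm_of_nonneg hκ0.le] at hle
  have hf0 : ‖f 0‖ = ‖F w‖ ^ 2 := by simp [hf]
  rw [hf0] at hle
  have hM0 : 0 ≤ M := integral_nonneg fun _ => by positivity
  refine abs_le_of_sq_le_sq' ?_ (by positivity) |>.2
  rw [mul_pow, Real.sq_sqrt (by positivity), ← Real.exp_nat_mul]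
  have : ((2 : ℕ) : ℝ) * (Complex.normSq w / 2) = Complex.normSq w := by push_cast; ring
  rw [this, div_mul_eq_mul_div, le_div_iff₀ hκ0]
  linarith

lemma norm_betaP_le {F : ℂ → ℂ} {C : ℝ} (hC : ∀ w : ℂ, ‖F w‖ ≤ C * Real.exp (Complex.normSq w / 2))
    {h : ℝ} (hh : 0 ≤ h) (z : ℂ) (t : ℝ) (ζ : ℂ) :
    ‖betaP h z t F ζ‖ ≤ C * Real.exp (Complex.normSq ζ / 2) := by
  obtain ⟨k, hk, rfl⟩ : ∃ k : ℝ, 0 ≤ k ∧ h = k ^ 2 := ⟨√h, Real.sqrt_nonneg h, (Real.sq_sqrt hh).symm⟩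
  unfold betaP
  rw [norm_mul, Complex.norm_exp, Real.sqrt_sq hk]
  refine (mul_le_mul_of_nonneg_left (hC _) (Real.exp_pos _).le).trans_eq ?_
  rw [mul_left_comm, ← Real.exp_add]
  congr 2
  simp [Complex.normSq_apply, pow_two]
  ring

lemma norm_betaStar_le {F : ℂ → ℂ} {C : ℝ}
    (hC : ∀ w : ℂ, ‖F w‖ ≤ C * Real.exp (Complex.normSq w / 2)) (h : ℝ) (p : ℂ × ℝ) (ζ : ℂ) :
    ‖betaStar h p F ζ‖ ≤ C * Real.exp (Complex.normSq ζ / 2) := by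
  unfold betaStar beta
  split_ifs with hh
  · exact norm_betaP_le hC hh.le _ _ _
  · exact norm_betaP_le hC (abs_nonneg h) _ _ _

lemma continuous_betaStar {F : ℂ → ℂ} (hF : Continuous F) (h : ℝ) (ζ : ℂ) :
    Continuous fun p => betaStar h p F ζ := by
  have := Complex.continuous_normSq
  by_cases hh : 0 < h
  · simp only [betaStar, beta, if_pos hh, betaP]
    fun_prop
  · simp only [betaStar, beta, if_neg hh, betaP]
    fun_prop

/-- Right translation by a fixed element of the Heisenberg group. -/
def hmulRight (q : ℂ × ℝ) : (ℂ × ℝ) ≃ₜ (ℂ × ℝ) where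
  toFun p := hmul p q
  invFun p := hmul p (hinv q)
  left_inv p := hmul_hinv_cancel_right p q
  right_inv p := hmul_hinv_cancel_left p q
  continuous_toFun := continuous_hmul.comp (by fun_prop : Continuous fun p => (p, q))
  continuous_invFun := continuous_hmul.comp (by fun_prop : Continuous fun p => (p, hinv q))

lemma measurePreserving_hmul_right (q : ℂ × ℝ) : MeasurePreserving fun p => hmul p q := by
  refine (measurePreserving_add_right (volume : Measure ℂ) q.1).skew_product
    (g := fun (z : ℂ) (t : ℝ) => t + q.2 + (z.re * q.1.im - z.im * q.1.re) / 2) ?_ ?_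
  · refine Continuous.measurable ?_
    simp only [Function.uncurry_def]
    fun_prop
  · refine Filter.Eventually.of_forall fun z => ?_
    simp only [add_assoc]
    exact map_add_right_eq_self volume _

instance vaddInvariantMeasure_zmultiples (v : ℂ × ℝ) :
    VAddInvariantMeasure (AddSubgroup.zmultiples v) (ℂ × ℝ) volume where
  measure_preimage_vadd a s _ := by
    have : (volume : Measure (ℂ × ℝ)).IsAddLeftInvariant :=
      Measure.prod.instIsAddLeftInvariant
    exact measure_preimage_add volume (a : ℂ × ℝ) s

/-- The strip `ℂ × [0,T)` is a fundamental domain for translations by `(0,T)`. -/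
lemma isAddFundamentalDomain_strip {T : ℝ} (hT : 0 < T) :
    IsAddFundamentalDomain (AddSubgroup.zmultiples ((0, T) : ℂ × ℝ))
      ((Set.univ : Set ℂ) ×ˢ Set.Ico (0 : ℝ) T) := by
  refine IsAddFundamentalDomain.mk' (MeasurableSet.univ.prod measurableSet_Ico).nullMeasurableSet
    fun x => ?_
  obtain ⟨m, hm, huniq⟩ := existsUnique_add_zsmul_mem_Ico hT x.2 0
  rw [zero_add] at hm huniq
  refine ⟨⟨m • ((0, T) : ℂ × ℝ), m, rfl⟩, ⟨trivial, ?_⟩, ?_⟩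
  · simpa [AddSubgroup.vadd_def, add_comm] using hm
  · rintro ⟨_, k, rfl⟩ hk
    have : k = m := huniq k (by simpa [AddSubgroup.vadd_def, add_comm] using hk.2)
    simp [this]

lemma isAddFundamentalDomain_strip_hmul {T : ℝ} (hT : 0 < T) (q : ℂ × ℝ) :
    IsAddFundamentalDomain (AddSubgroup.zmultiples ((0, T) : ℂ × ℝ))
      ((fun p => hmul p q) ⁻¹' ((Set.univ : Set ℂ) ×ˢ Set.Ico (0 : ℝ) T)) := by
  refine (isAddFundamentalDomain_strip hT).preimage_of_equiv
    (measurePreserving_hmul_right q).quasiMeasurePreserving (e := id) Function.bijective_id ?_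
  rintro ⟨_, k, rfl⟩ p
  ext <;> simp [AddSubgroup.vadd_def, hmul, add_assoc]

lemma vadd_eq_of_periodic {E : Type*} {Φ : ℂ × ℝ → E} {T : ℝ}
    (hΦ : ∀ z t, Φ (z, t + T) = Φ (z, t))
    (a : AddSubgroup.zmultiples ((0, T) : ℂ × ℝ)) (p : ℂ × ℝ) : Φ (a +ᵥ p) = Φ p := by
  obtain ⟨_, k, rfl⟩ := a
  have hp : Function.Periodic (fun t => Φ (p.1, t)) T := hΦ p.1
  have hk : (⟨k • ((0, T) : ℂ × ℝ), k, rfl⟩ : AddSubgroup.zmultiples ((0, T) : ℂ × ℝ)) +ᵥ p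
      = (p.1, p.2 + k • T) := by
    ext <;> simp [AddSubgroup.vadd_def, add_comm]
  exact (congrArg Φ hk).trans (hp.zsmul k p.2)

lemma aestronglyMeasurable_of_periodic {Φ : ℂ × ℝ → ℂ} {T : ℝ} (hT : 0 < T)
    (hΦ : ∀ z t, Φ (z, t + T) = Φ (z, t))
    (hm : AEStronglyMeasurable Φ
      (volume.restrict ((Set.univ : Set ℂ) ×ˢ Set.Ico (0 : ℝ) T))) :
    AEStronglyMeasurable Φ volume := by
  have hs := isAddFundamentalDomain_strip hT
  rw [← hs.sum_restrict, aestronglyMeasurable_sum_measure_iff]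
  exact fun a =>
    (hs.aestronglyMeasurable_on_iff (hs.vadd_of_comm a) (vadd_eq_of_periodic hΦ)).1 hm

lemma hmul_add_period {E : Type*} {Φ : ℂ × ℝ → E} {T : ℝ}
    (hΦ : ∀ z t, Φ (z, t + T) = Φ (z, t)) (q : ℂ × ℝ) (z : ℂ) (t : ℝ) :
    Φ (hmul (z, t + T) q) = Φ (hmul (z, t) q) := by
  rw [← hΦ (hmul (z, t) q).1]
  congr 1
  ext <;> simp [hmul]
  ring

/-- Integration over a period strip is invariant under right translations. -/
lemma setIntegral_strip_hmul {E : Type*} [NormedAddCommGroup E] [NormedSpace ℝ E]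
    {Φ : ℂ × ℝ → E} {T : ℝ} (hT : 0 < T) (hΦ : ∀ z t, Φ (z, t + T) = Φ (z, t)) (q : ℂ × ℝ) :
    ∫ p in (Set.univ : Set ℂ) ×ˢ Set.Ico (0 : ℝ) T, Φ (hmul p q)
      = ∫ p in (Set.univ : Set ℂ) ×ˢ Set.Ico (0 : ℝ) T, Φ p := by
  rw [(isAddFundamentalDomain_strip hT).setIntegral_eq (isAddFundamentalDomain_strip_hmul hT q)
    (vadd_eq_of_periodic (Φ := fun p => Φ (hmul p q)) (hmul_add_period hΦ q))]
  exact (measurePreserving_hmul_right q).setIntegral_preimage_emb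
    (hmulRight q).measurableEmbedding Φ _

lemma integrableOn_strip_hmul {E : Type*} [NormedAddCommGroup E]
    {Φ : ℂ × ℝ → E} {T : ℝ} (hT : 0 < T) (hΦ : ∀ z t, Φ (z, t + T) = Φ (z, t)) (q : ℂ × ℝ)
    (hi : IntegrableOn Φ ((Set.univ : Set ℂ) ×ˢ Set.Ico (0 : ℝ) T)) :
    IntegrableOn (fun p => Φ (hmul p q)) ((Set.univ : Set ℂ) ×ˢ Set.Ico (0 : ℝ) T) := by
  rw [(isAddFundamentalDomain_strip hT).integrableOn_iff (isAddFundamentalDomain_strip_hmul hT q)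
    (vadd_eq_of_periodic (Φ := fun p => Φ (hmul p q)) (hmul_add_period hΦ q))]
  exact ((measurePreserving_hmul_right q).integrableOn_comp_preimage
    (hmulRight q).measurableEmbedding).2 hi

/-- Translating a periodic, strip-integrable function along a bounded piece of a continuous curve
gives a jointly integrable function. -/
lemma integrable_hmul_curve {g : ℂ × ℝ → ℂ} {T : ℝ} (hT : 0 < T)
    (hper : ∀ z t, g (z, t + T) = g (z, t))
    (hint : IntegrableOn g ((Set.univ : Set ℂ) ×ˢ Set.Ico (0 : ℝ) T))
    {γ : ℝ → ℂ × ℝ} (hγ : Continuous γ) (a b : ℝ) :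
    Integrable (fun x : ℝ × (ℂ × ℝ) => g (hmul x.2 (γ x.1)))
      ((volume.restrict (Set.uIoc a b)).prod
        (volume.restrict ((Set.univ : Set ℂ) ×ˢ Set.Ico (0 : ℝ) T))) := by
  have hfin : IsFiniteMeasure ((volume : Measure ℝ).restrict (Set.uIoc a b)) :=
    isFiniteMeasure_restrict.2 (by simp [Set.uIoc])
  have hskew : MeasurePreserving (fun x : ℝ × (ℂ × ℝ) => (x.1, hmul x.2 (γ x.1)))
      ((volume.restrict (Set.uIoc a b)).prod volume)
      ((volume.restrict (Set.uIoc a b)).prod volume) := by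
    refine (MeasurePreserving.id _).skew_product (g := fun s p => hmul p (γ s)) ?_ ?_
    · refine Continuous.measurable ?_
      exact continuous_hmul.comp
        (by fun_prop : Continuous fun x : ℝ × (ℂ × ℝ) => (x.2, γ x.1))
    · exact Filter.Eventually.of_forall fun s => (measurePreserving_hmul_right (γ s)).map_eq
  have hmeas : AEStronglyMeasurable (fun x : ℝ × (ℂ × ℝ) => g (hmul x.2 (γ x.1)))
      ((volume.restrict (Set.uIoc a b)).prod volume) :=
    (aestronglyMeasurable_of_periodic hT hper hint.1).comp_snd.comp_measurePreserving hskew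
  rw [integrable_prod_iff
    (hmeas.mono_ac (Measure.AbsolutelyContinuous.rfl.prod Measure.restrict_le_self.absolutelyContinuous))]
  refine ⟨Filter.Eventually.of_forall fun s => integrableOn_strip_hmul hT hper (γ s) hint, ?_⟩
  have hn : ∀ z t, ‖g (z, t + T)‖ = ‖g (z, t)‖ := fun z t => by rw [hper]
  simp only [setIntegral_strip_hmul (Φ := fun p => ‖g p‖) hT hn]
  exact integrable_const _

lemma continuous_geoE (eps lam : ℝ) : Continuous (geoE eps lam) := by
  unfold geoE
  fun_prop

/-- **Fourier multiplier of the reduced taming X-ray transform:**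
for `g` that is `π(1+2ε²)`-periodic in `t` and integrable on `ℂ×[0,π(1+2ε²))`,
`𝓕_{ℍ/Γ^ε}(I^{ε,red} g)(n) = 2π 𝒥_n(1/√(1+2ε²)) ∘ 𝓕_{ℍ/Γ^ε}(g)(n)` pointwise on `𝓗`. -/
theorem reduced_taming_xray_multiplier (eps : ℝ) (heps : 0 < eps)
    (g : ℂ × ℝ → ℂ)
    (hper : ∀ z : ℂ, ∀ t : ℝ, g (z, t + π * (1 + 2 * eps ^ 2)) = g (z, t))
    (hint : IntegrableOn g ((Set.univ : Set ℂ) ×ˢ Set.Ico (0 : ℝ) (π * (1 + 2 * eps ^ 2))))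
    (n : ℤ) (hn : n ≠ 0) (F : ℂ → ℂ) (hF : InFock F) (ζ : ℂ) :
    ∫ p in (Set.univ : Set ℂ) ×ˢ Set.Ico (0 : ℝ) (π * (1 + 2 * eps ^ 2)),
        (∫ s in (0 : ℝ)..(2 * π), g (hmul p (geoE eps 1 s)))
          * betaStar ((n : ℝ) / (1 + 2 * eps ^ 2)) p F ζ
      = ((2 * π : ℝ) : ℂ) *
          Jop n (1 / Real.sqrt (1 + 2 * eps ^ 2))
            (fun ξ => ∫ p in (Set.univ : Set ℂ) ×ˢ Set.Ico (0 : ℝ) (π * (1 + 2 * eps ^ 2)),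
              g p * betaStar ((n : ℝ) / (1 + 2 * eps ^ 2)) p F ξ) ζ := by
  set c : ℝ := 1 + 2 * eps ^ 2 with hc
  have hc0 : 0 < c := by positivity
  have hT : 0 < π * c := by positivity
  have hnT : (n : ℝ) / c * (π * c) = π * n := by field_simp
  obtain ⟨C, hC⟩ := hF.norm_le
  have hjoint := (integrable_hmul_curve hT hper hint (continuous_geoE eps 1) 0 (2 * π)).mul_bdd
    (c := C * Real.exp (Complex.normSq ζ / 2))
    (g := fun x : ℝ × (ℂ × ℝ) => betaStar ((n : ℝ) / c) x.2 F ζ)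
    ((continuous_betaStar hF.1.continuous _ ζ).comp continuous_snd).aestronglyMeasurable
    (Filter.Eventually.of_forall fun x => norm_betaStar_le hC _ _ _)
  simp only [← intervalIntegral.integral_mul_const]
  rw [← intervalIntegral_integral_swap
    (f := fun s p => g (hmul p (geoE eps 1 s)) * betaStar ((n : ℝ) / c) p F ζ) hjoint]
  have hpi : ((2 * π : ℝ) : ℂ) * ((1 / (2 * π) : ℝ) : ℂ) = 1 := by
    rw [← Complex.ofReal_mul, mul_one_div_cancel (by positivity), Complex.ofReal_one]
  rw [Jop, ← mul_assoc, hpi, one_mul]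
  refine intervalIntegral.integral_congr fun s _ => ?_
  have hgeo : geoE eps 1 s = (Complex.exp (Complex.I * (s : ℂ)), c * (s / 2)) := by
    refine Prod.ext (by simp [geoE]) ?_
    simp [geoE, hc]
    ring
  have hΦ : ∀ z t, (fun p => g p * betaStar ((n : ℝ) / c) (hmul p (hinv (geoE eps 1 s))) F ζ)
      (z, t + π * c)
        = (fun p => g p * betaStar ((n : ℝ) / c) (hmul p (hinv (geoE eps 1 s))) F ζ) (z, t) := by
    intro z t
    have := hmul_add_period (Φ := fun p => betaStar ((n : ℝ) / c) p F ζ) (T := π * c)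
      (fun z t => betaStar_add_period hnT z t F ζ) (hinv (geoE eps 1 s)) z t
    simp only [hper, this]
  have key := setIntegral_strip_hmul
    (Φ := fun p => g p * betaStar ((n : ℝ) / c) (hmul p (hinv (geoE eps 1 s))) F ζ) hT hΦ (geoE eps 1 s)
  simp only [hmul_hinv_cancel_right] at key
  simp only [key, betaStar_hmul_hinv, beta_dilate hc0]
  rw [integral_mul_beta, hgeo]

end
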